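/- For all a ≥ 0 and b ∈ ℝ, √a · 𝒢(a,b) ≤ max( l²·√(max(b,0)) , 2l/√(2π) ). -/

import Mathlib

noncomputable def Phi (x : ℝ) : ℝ :=
  (Real.sqrt (2 * Real.pi))⁻¹ * ∫ y in Set.Iic x, Real.exp (-y ^ 2 / 2)

/-- The function `Γ` from the paper (depending on the parameter `l`). -/
noncomputable def Gam (l a b : ℝ) : ℝ :=
  if 0 < a then
    l ^ 2 * Phi (-(l * b) / (2 * Real.sqrt a))
      + l ^ 2 * Real.exp (l ^ 2 * (a - b) / 2) * Phi (l * (b / (2 * Real.sqrt a) - Real.sqrt a))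
  else l ^ 2 * Real.exp (-(l ^ 2 * max b 0) / 2)

/-- The function `𝒢` from the paper (depending on the parameter `l`). -/
noncomputable def Gcal (l a b : ℝ) : ℝ :=
  if 0 < a then
    l ^ 2 * Real.exp (l ^ 2 * (a - b) / 2) * Phi (l * (b / (2 * Real.sqrt a) - Real.sqrt a))
  else if 0 < b then l ^ 2 * Real.exp (-(l ^ 2 * b) / 2) else 0

theorem integrable_exp_neg_sq_div_two :
    MeasureTheory.Integrable (fun y : ℝ => Real.exp (-y ^ 2 / 2)) := by
  convert integrable_exp_neg_mul_sq (b := 1 / 2) (by norm_num) using 3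
  ring

theorem Phi_nonneg (x : ℝ) : 0 ≤ Phi x :=
  mul_nonneg (by positivity) (MeasureTheory.integral_nonneg fun _ => (Real.exp_pos _).le)

theorem Phi_le_one (x : ℝ) : Phi x ≤ 1 := by
  have hle : ∫ y in Set.Iic x, Real.exp (-y ^ 2 / 2) ≤ Real.sqrt (2 * Real.pi) := by
    have htotal : ∫ y : ℝ, Real.exp (-y ^ 2 / 2) = Real.sqrt (2 * Real.pi) := by
      convert integral_gaussian (1 / 2) using 3
      · ring_nf
      · ring
    rw [← htotal]
    exact MeasureTheory.setIntegral_le_integral integrable_exp_neg_sq_div_two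
      (.of_forall fun y => (Real.exp_pos _).le)
  rw [Phi, inv_mul_le_one₀ (by positivity)]
  exact hle

/-- Mills' ratio bound for the lower Gaussian tail. -/
theorem Phi_le_of_neg {x : ℝ} (hx : x < 0) :
    Phi x ≤ (Real.sqrt (2 * Real.pi))⁻¹ * (Real.exp (-x ^ 2 / 2) / -x) := by
  unfold Phi
  gcongr
  have htangent : ∫ y in Set.Iic x, Real.exp (x ^ 2 / 2) * Real.exp (-x * y)
      = Real.exp (-x ^ 2 / 2) / -x := by
    rw [MeasureTheory.integral_const_mul, integral_exp_mul_Iic (neg_pos.2 hx), ← mul_div_assoc,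
      ← Real.exp_add]
    ring_nf
  rw [← htangent]
  refine MeasureTheory.integral_mono integrable_exp_neg_sq_div_two.integrableOn
    ((integrableOn_exp_mul_Iic (neg_pos.2 hx) x).const_mul _) fun y => ?_
  dsimp only
  rw [← Real.exp_add, Real.exp_le_exp]
  nlinarith [sq_nonneg (y - x)]

theorem stmt_4 (l : ℝ) (hl : 0 < l) (a : ℝ) (ha : 0 ≤ a) (b : ℝ) :
    Real.sqrt a * Gcal l a b ≤
      max (l ^ 2 * Real.sqrt (max b 0)) (2 * l / Real.sqrt (2 * Real.pi)) := by
  rcases ha.eq_or_lt with rfl | ha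
  · rw [Real.sqrt_zero, zero_mul]
    positivity
  rw [Gcal, if_pos ha]
  have hs : 0 < Real.sqrt a := Real.sqrt_pos.2 ha
  have hsa : Real.sqrt a ^ 2 = a := Real.sq_sqrt ha.le
  set s := Real.sqrt a
  rcases le_or_gt a b with hab | hab
  · refine le_max_of_le_left ?_
    have hexp : Real.exp (l ^ 2 * (a - b) / 2) ≤ 1 := by
      rw [Real.exp_le_one_iff]
      nlinarith [mul_nonneg (sq_nonneg l) (sub_nonneg.2 hab)]
    have hsb : s ≤ Real.sqrt (max b 0) := Real.sqrt_le_sqrt (hab.trans (le_max_left _ _))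
    calc s * (l ^ 2 * Real.exp (l ^ 2 * (a - b) / 2) * Phi (l * (b / (2 * s) - s)))
        ≤ s * (l ^ 2 * 1 * 1) := by
          gcongr
          · exact Phi_nonneg _
          · exact Phi_le_one _
      _ ≤ l ^ 2 * Real.sqrt (max b 0) := by nlinarith [sq_nonneg l]
  · refine le_max_of_le_right ?_
    set x := l * (b / (2 * s) - s) with hx_def
    have hxs : l * s / 2 ≤ -x := by
      have hbs : b / (2 * s) ≤ s / 2 := by
        rw [div_le_iff₀ (by positivity)]
        nlinarith
      rw [hx_def]
      nlinarith
    have hls : 0 < l * s / 2 := by positivity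
    have hexp : Real.exp (l ^ 2 * (a - b) / 2) * Real.exp (-x ^ 2 / 2) ≤ 1 := by
      rw [← Real.exp_add, Real.exp_le_one_iff]
      have hsum : l ^ 2 * (a - b) / 2 + -x ^ 2 / 2 = -(l * (b / (2 * s))) ^ 2 / 2 := by
        rw [hx_def, ← hsa]
        field_simp
        ring
      rw [hsum]
      nlinarith [sq_nonneg (l * (b / (2 * s)))]
    calc s * (l ^ 2 * Real.exp (l ^ 2 * (a - b) / 2) * Phi x)
        ≤ s * (l ^ 2 * Real.exp (l ^ 2 * (a - b) / 2) *
            ((Real.sqrt (2 * Real.pi))⁻¹ * (Real.exp (-x ^ 2 / 2) / -x))) := by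
          gcongr
          exact Phi_le_of_neg (by linarith)
      _ = s * l ^ 2 * (Real.sqrt (2 * Real.pi))⁻¹ *
            (Real.exp (l ^ 2 * (a - b) / 2) * Real.exp (-x ^ 2 / 2) / -x) := by ring
      _ ≤ s * l ^ 2 * (Real.sqrt (2 * Real.pi))⁻¹ * (1 / (l * s / 2)) := by gcongr
      _ = 2 * l / Real.sqrt (2 * Real.pi) := by field_simp
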